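/- arXiv:1707.06776 — 5 statements merged into one kernel-verified Lean document; each statement's English description precedes it below -/
import Mathlib

section
/- For every (x,y) ∈ D, min{f₁(x,y), f₂(x,y), f₃(x,y), f₄(x,y), f₅(x,y), f₆(x,y)} = min{f₃(x,y), f₄(x,y), f₅(x,y), f₆(x,y)}. (This is the reduction of the optimization problem (3) of the paper to the optimization problem (4), which follows from Lemmas 9 and 10.) -/
/-- Reduction of optimization problem (3) to (4): on the domain
`D = {(x,y) : 0 < y ≤ x < 1, x + y < 1}`, the minimum of the six competitive
ratio functions equals the minimum of `f₃, f₄, f₅, f₆`. -/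
theorem min_six_eq_min_four (x y : ℝ) (hy : 0 < y) (hyx : y ≤ x) (hx : x < 1)
    (hxy : x + y < 1) :
    min (max ((1 - y) / (1 - x - y)) (1 / y))      -- f₁
      (min (max ((1 - y) / x) (1 / y))             -- f₂
        (min (max (1 / (1 - x)) ((1 - x) / y))     -- f₃
          (min (max (1 / x) ((1 - x) / y))         -- f₄
            (min (1 / (1 - x - y))                 -- f₅
              (max (1 / x) ((1 - x) / (1 - x - y))))))) -- f₆
    =
    min (max (1 / (1 - x)) ((1 - x) / y))          -- f₃
      (min (max (1 / x) ((1 - x) / y))             -- f₄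
        (min (1 / (1 - x - y))                     -- f₅
          (max (1 / x) ((1 - x) / (1 - x - y))))) := by  -- f₆
  have hxy' : 0 < 1 - x - y := by linarith
  have hdiv : (1 - x) / y ≤ 1 / y := by gcongr; linarith
  have h₁ : max (1 / (1 - x)) ((1 - x) / y) ≤ max ((1 - y) / (1 - x - y)) (1 / y) := by
    refine max_le_max ?_ hdiv
    rw [div_le_div_iff₀ (by linarith) hxy']
    nlinarith [mul_pos (hy.trans_le hyx) hy]
  have h₂ : max (1 / x) ((1 - x) / y) ≤ max ((1 - y) / x) (1 / y) :=
    le_max_of_le_right (max_le (one_div_le_one_div_of_le hy hyx) hdiv)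
  rw [min_eq_right (b := min (max ((1 - y) / x) (1 / y)) _), min_eq_right]
  · exact (min_le_right _ _).trans ((min_le_left _ _).trans h₂)
  · exact (min_le_right _ _).trans ((min_le_left _ _).trans h₁)
end

section
/- For all real numbers x, y with 0 < y ≤ x < 1 and x + y < 1, one has f₆(x,y) ≤ 1 + φ if and only if x ≥ 1/(1+φ) and y ≤ φ/(1+φ) − φx/(1+φ). (Lemma 14 of the paper: characterization of the region R(f₆).) -/
/-- Lemma 14: characterization of the region `R(f₆)`. -/
theorem region_f6 (x y : ℝ) (hy : 0 < y) (hyx : y ≤ x) (hx : x < 1)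
    (hxy : x + y < 1) :
    let φ : ℝ := (1 + Real.sqrt 5) / 2
    (max (1 / x) ((1 - x) / (1 - x - y)) ≤ 1 + φ ↔
      x ≥ 1 / (1 + φ) ∧ y ≤ φ / (1 + φ) - φ * x / (1 + φ)) := by
  intro φ
  have hφ : 0 < 1 + φ := by positivity
  have hx₀ : 0 < x := hy.trans_le hyx
  have hgap : 0 < 1 - x - y := by linarith
  rw [max_le_iff, ge_iff_le, ← sub_div, le_div_iff₀ hφ, div_le_iff₀ hgap]
  refine and_congr (one_div_le hx₀ hφ) ?_
  constructor <;> intro h <;> linarith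
end

section
/- Every point (x,y) ∈ ℝ² with 0 ≤ y ≤ x ≤ 1 and x + y ≤ 1 belongs to R₃ ∪ R₄ ∪ R₅ ∪ R₆. (Lemma 15 of the paper: the four regions cover the feasible domain of initial configurations.) -/
/-- Lemma 15: the regions `R₃, R₄, R₅, R₆` cover the feasible domain
`{(x,y) : 0 ≤ y ≤ x ≤ 1, x + y ≤ 1}`. -/
theorem regions_cover (x y : ℝ) (hy : 0 ≤ y) (hyx : y ≤ x) (hx : x ≤ 1)
    (hxy : x + y ≤ 1) :
    let φ : ℝ := (1 + Real.sqrt 5) / 2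
    (x ≤ φ / (1 + φ) ∧ y ≥ 1 / (1 + φ) - x / (1 + φ)) ∨       -- R₃
    (x ≥ 1 / (1 + φ) ∧ y ≥ 1 / (1 + φ) - x / (1 + φ)) ∨       -- R₄
    (y ≤ φ / (1 + φ) - x) ∨                                   -- R₅
    (x ≥ 1 / (1 + φ) ∧ y ≤ φ / (1 + φ) - φ * x / (1 + φ)) := by -- R₆
  intro φ
  have hφ_sq : φ ^ 2 = φ + 1 := Real.goldenRatio_sq
  have hφ_one : 1 < φ := Real.one_lt_goldenRatio
  have hpos : 0 < 1 + φ := by linarith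
  set a := 1 / (1 + φ) with ha
  have ha_pos : 0 < a := by positivity
  have hb : φ / (1 + φ) = 1 - a := by rw [ha]; field_simp; ring
  have hxa : x / (1 + φ) = a * x := by rw [ha]; ring
  have hxb : φ * x / (1 + φ) = (1 - a) * x := by rw [← hb]; ring
  have ha_half : a < 1 / 2 := by
    rw [ha]
    exact one_div_lt_one_div_of_lt two_pos (by linarith)
  have ha_root : a + a * (1 - a) = 1 - a := by
    rw [ha]
    field_simp
    linear_combination -hφ_sq
  rw [hb, hxa, hxb]
  by_cases hlow : a - a * x ≤ y
  · rcases le_total x a with h | h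
    · exact Or.inl ⟨by linarith, hlow⟩
    · exact Or.inr (Or.inl ⟨h, hlow⟩)
  · push Not at hlow
    rcases le_total x a with h | h
    · exact Or.inr (Or.inr (Or.inl (by nlinarith)))
    · exact Or.inr (Or.inr (Or.inr ⟨h, by nlinarith⟩))
end

section
/- For every (x,y) ∈ D, min{f₃(x,y), f₄(x,y), f₅(x,y), f₆(x,y)} ≤ 1 + φ. (The mathematical core of Theorem 9: algorithm FRR, which at each configuration executes the schedule among Cases 3–6 whose region contains (x,y), has competitive ratio at most 1 + φ.) -/
/-- Core of Theorem 9 (upper bound for algorithm FRR): for every `(x, y)` in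
`D = {(x,y) : 0 < y ≤ x < 1, x + y < 1}`,
`min {f₃(x,y), f₄(x,y), f₅(x,y), f₆(x,y)} ≤ 1 + φ`. -/
theorem min_four_le (x y : ℝ) (hy : 0 < y) (hyx : y ≤ x) (hx : x < 1)
    (hxy : x + y < 1) :
    let φ : ℝ := (1 + Real.sqrt 5) / 2
    min (max (1 / (1 - x)) ((1 - x) / y))          -- f₃
      (min (max (1 / x) ((1 - x) / y))             -- f₄
        (min (1 / (1 - x - y))                     -- f₅
          (max (1 / x) ((1 - x) / (1 - x - y)))))  -- f₆
      ≤ 1 + φ := by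
  intro φ
  have hφ : φ ^ 2 = φ + 1 := Real.goldenRatio_sq
  have hφ1 : 1 < φ := Real.one_lt_goldenRatio
  have hc : (1 + φ) * (2 - φ) = 1 := by linear_combination -hφ
  have hc0 : 0 < 1 + φ := by linarith
  have hx0 : 0 < x := hy.trans_le hyx
  have h1x : 0 < 1 - x := by linarith
  have hz : 0 < 1 - x - y := by linarith
  -- `2 - φ` is the inverse of `1 + φ`.
  have key : ∀ a b : ℝ, 0 < b → (2 - φ) * a ≤ b → a / b ≤ 1 + φ := by
    intro a b hb h
    rw [div_le_iff₀ hb]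
    calc a = (1 + φ) * ((2 - φ) * a) := by rw [← mul_assoc, hc, one_mul]
      _ ≤ (1 + φ) * b := mul_le_mul_of_nonneg_left h hc0.le
  simp only [min_le_iff, max_le_iff]
  by_cases h5 : 2 - φ ≤ 1 - x - y
  · exact Or.inr (Or.inr (Or.inl (key _ _ hz (by linarith))))
  push Not at h5
  rcases le_or_gt (2 - φ) x with h | h
  · have hfx : 1 / x ≤ 1 + φ := key _ _ hx0 (by linarith)
    rcases le_or_gt ((2 - φ) * (1 - x)) y with h4 | h4
    · exact Or.inr (Or.inl ⟨hfx, key _ _ hy h4⟩)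
    · refine Or.inr (Or.inr (Or.inr ⟨hfx, key _ _ hz ?_⟩))
      nlinarith [mul_pos h1x (sub_pos.2 hφ1)]
  · refine Or.inl ⟨key _ _ h1x ?_, key _ _ hy ?_⟩
    · nlinarith
    · nlinarith [mul_pos (sub_pos.2 hφ1) (sub_pos.2 h)]
end

section
/- The function (x,y) ↦ min{f₁(x,y), f₂(x,y), f₃(x,y), f₄(x,y), f₅(x,y), f₆(x,y)} attains a maximum value of exactly 1 + φ over D, and this maximum is attained at the point (x₀, y₀) = (1/(1+φ), 1/(φ(1+φ))) ∈ D. (The combined content of Theorems 8 and 9: the optimal competitive ratio for rendezvous of four robots, exactly two of which are byzantine faulty, equals 1 + φ.) -/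
/-- Theorems 8 and 9 combined: the function
`(x,y) ↦ min {f₁(x,y), …, f₆(x,y)}` attains a maximum value of exactly `1 + φ`
over `D = {(x,y) : 0 < y ≤ x < 1, x + y < 1}`, attained at
`(x₀, y₀) = (1/(1+φ), 1/(φ(1+φ)))`. -/
theorem optimal_competitive_ratio :
    let φ : ℝ := (1 + Real.sqrt 5) / 2
    let F : ℝ → ℝ → ℝ := fun x y =>
      min (max ((1 - y) / (1 - x - y)) (1 / y))
        (min (max ((1 - y) / x) (1 / y))
          (min (max (1 / (1 - x)) ((1 - x) / y))
            (min (max (1 / x) ((1 - x) / y))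
              (min (1 / (1 - x - y))
                (max (1 / x) ((1 - x) / (1 - x - y)))))))
    let x₀ : ℝ := 1 / (1 + φ)
    let y₀ : ℝ := 1 / (φ * (1 + φ))
    (0 < y₀ ∧ y₀ ≤ x₀ ∧ x₀ < 1 ∧ x₀ + y₀ < 1) ∧
    F x₀ y₀ = 1 + φ ∧
    ∀ x y : ℝ, 0 < y → y ≤ x → x < 1 → x + y < 1 → F x y ≤ 1 + φ := by
  intro φ F x₀ y₀
  have hsq : φ ^ 2 = φ + 1 := Real.goldenRatio_sq
  have h1 : 1 < φ := Real.one_lt_goldenRatio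
  have hinv : (1 + φ) * (2 - φ) = 1 := by linear_combination -hsq
  have hx₀ : x₀ = 2 - φ := by
    change 1 / (1 + φ) = 2 - φ
    rw [div_eq_iff (by positivity)]
    linear_combination -hinv
  have hy₀ : y₀ = 2 * φ - 3 := by
    change 1 / (φ * (1 + φ)) = 2 * φ - 3
    rw [div_eq_iff (by positivity)]
    linear_combination -(2 * φ + 1) * hsq
  have hlow : 3 / 2 < φ := by nlinarith
  have hupp : φ < 5 / 3 := by nlinarith
  have hx : 1 / (2 - φ) = 1 + φ := by
    rw [div_eq_iff (by linarith)]
    exact hinv.symm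
  refine ⟨⟨by linarith, by linarith, by linarith, by linarith⟩, ?_, ?_⟩
  · have hy : 1 + φ ≤ 1 / (2 * φ - 3) := by
      rw [le_div_iff₀ (by linarith)]
      nlinarith
    have hxy : (1 - (2 - φ)) / (2 * φ - 3) = 1 + φ := by
      rw [div_eq_iff (by linarith)]
      linear_combination -2 * hsq
    have hz : 1 - (2 - φ) - (2 * φ - 3) = 2 - φ := by ring
    have hx₁ : 1 / (1 - (2 - φ)) ≤ 1 + φ := by
      rw [div_le_iff₀ (by linarith)]
      nlinarith
    have hx₂ : (1 - (2 - φ)) / (2 - φ) ≤ 1 + φ := by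
      rw [← hx]
      gcongr <;> linarith
    simp only [F, hx₀, hy₀, hz, hxy, hx, max_self, max_eq_left hx₂, max_eq_right hx₁, min_self,
      min_eq_right (le_max_of_le_right hy)]
  · intro x y hy _ hx1 hxy
    by_contra! h
    simp only [F, lt_min_iff] at h
    obtain ⟨-, -, h₃, h₄, h₅, h₆⟩ := h
    rw [lt_max_iff, lt_div_iff₀ (by linarith), lt_div_iff₀ hy] at h₃
    rw [lt_max_iff, lt_div_iff₀ (by linarith), lt_div_iff₀ hy] at h₄
    rw [lt_div_iff₀ (by linarith)] at h₅
    rw [lt_max_iff, lt_div_iff₀ (by linarith), lt_div_iff₀ (by linarith)] at h₆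
    have hsum : φ - 1 < x + y := by nlinarith
    have hxy' : (1 + φ) * y < 1 - x := by
      rcases h₃ with h₃ | h₃
      · rcases h₄ with h₄ | h₄
        · nlinarith
        · exact h₄
      · exact h₃
    rcases h₆ with h₆ | h₆
    · have hx' : x < 2 - φ := by nlinarith
      nlinarith
    · nlinarith
end
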